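/- For every right-most path γ in ℤ², |γ|/3 − 2 ≤ |∂⁺γ| ≤ 3|γ|. -/

import Mathlib

open MeasureTheory ProbabilityTheory Filter Pointwise ENNReal Classical

namespace Perc

/-- Vertices of the square lattice `ℤ²`. -/
abbrev V : Type := ℤ × ℤ

/-- Edges of `ℤ²`: `(v, false)` is the edge from `v` to `v + (1,0)`,
`(v, true)` is the edge from `v` to `v + (0,1)`.  This is a bijective encoding of the
set `ℰ²` of unordered nearest-neighbour pairs. -/
abbrev Edge : Type := V × Bool

def edgeFst (e : Edge) : V := e.1

def edgeSnd (e : Edge) : V := e.1 + (if e.2 then ((0 : ℤ), (1 : ℤ)) else ((1 : ℤ), (0 : ℤ)))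

/-- Nearest-neighbour adjacency in `ℤ²`. -/
def LatticeAdj (x y : V) : Prop := (x.1 - y.1).natAbs + (x.2 - y.2).natAbs = 1

/-- The oriented steps of a path recorded as its list of vertices. -/
def steps (l : List V) : List (V × V) := l.zip l.tail

/-- The unoriented edge corresponding to an oriented step between adjacent vertices. -/
def stepEdge (s : V × V) : Edge :=
  if s.2 = s.1 + ((1 : ℤ), (0 : ℤ)) then (s.1, false)
  else if s.2 = s.1 + ((0 : ℤ), (1 : ℤ)) then (s.1, true)
  else if s.1 = s.2 + ((1 : ℤ), (0 : ℤ)) then (s.2, false)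
  else (s.2, true)

/-- A path in `ℤ²`: a nonempty list of vertices with consecutive vertices adjacent. -/
def IsPath (l : List V) : Prop := l ≠ [] ∧ l.Chain' LatticeAdj

/-- The length (number of edges) of a path. -/
def pathLen (l : List V) : ℕ := l.length - 1

/-- All edges of the path are open in the configuration `ω`. -/
def IsOpenPath (ω : Edge → Bool) (l : List V) : Prop :=
  ∀ s ∈ steps l, ω (stepEdge s) = true

/-- The four lattice directions in counterclockwise order. -/
def dirVec (k : ℕ) : V :=
  if k % 4 = 0 then ((1 : ℤ), (0 : ℤ)) else if k % 4 = 1 then ((0 : ℤ), (1 : ℤ))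
  else if k % 4 = 2 then ((-1 : ℤ), (0 : ℤ)) else ((0 : ℤ), (-1 : ℤ))

def dirIdx (d : V) : ℕ :=
  if d = ((0 : ℤ), (1 : ℤ)) then 1 else if d = ((-1 : ℤ), (0 : ℤ)) then 2
  else if d = ((0 : ℤ), (-1 : ℤ)) then 3 else 0

/-- The (oriented) right-boundary edges of a path at an interior vertex `cur` with previous
vertex `prev` and next vertex `next`: the oriented edges emanating from `cur`, listed
counterclockwise strictly after `(cur, prev)` and strictly before `(cur, next)`. -/
def rbAt (prev cur next : V) : List (V × V) :=
  let a := dirIdx (prev - cur)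
  let b := (dirIdx (next - cur) + 4 - a) % 4
  let b' := if b = 0 then 4 else b
  ((List.range 4).filter fun k => decide (1 ≤ k ∧ k < b')).map
    fun k => (cur, cur + dirVec (a + k))

/-- The right boundary `∂⁺γ` of the path `γ`, as the list of all (oriented) right-boundary
edges collected at all interior vertices (each visit contributing separately). -/
def rightBoundary : List V → List (V × V)
  | a :: b :: c :: rest => rbAt a b c ++ rightBoundary (b :: c :: rest)
  | _ => []

/-- A right-most path: a simple path (no oriented edge traversed twice) which uses no edge of
its right boundary in either orientation. -/
def IsRightMost (l : List V) : Prop :=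
  IsPath l ∧ (steps l).Nodup ∧
    ∀ e ∈ rightBoundary l, e ∉ steps l ∧ (e.2, e.1) ∉ steps l

/-- `InR x y l` : `l` belongs to `𝓡(x,y)`, the set of right-most paths from `x` to `y`. -/
def InR (x y : V) (l : List V) : Prop :=
  IsRightMost l ∧ l.head? = some x ∧ l.getLast? = some y

/-- The right-boundary length `𝔟(γ)`: the number of open edges of `∂⁺γ` (both orientations
of an edge counting separately). -/
def bLen (ω : Edge → Bool) (l : List V) : ℕ :=
  ((rightBoundary l).filter fun s => ω (stepEdge s)).length

/-- The number `𝔭(γ)` of closed edges used by the path (orientations counted separately). -/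
def pLen (ω : Edge → Bool) (l : List V) : ℕ :=
  ((steps l).filter fun s => !(ω (stepEdge s))).length

/-- The right-boundary distance `b(x,y) = inf {𝔟(γ) : γ ∈ 𝓡(x,y) open}`. -/
noncomputable def bDist (ω : Edge → Bool) (x y : V) : ℝ :=
  sInf {r : ℝ | ∃ l, InR x y l ∧ IsOpenPath ω l ∧ r = (bLen ω l : ℝ)}

/-- `x` and `y` are connected by an open path in `ω`. -/
def ConnectedIn (ω : Edge → Bool) (x y : V) : Prop :=
  ∃ l, IsPath l ∧ IsOpenPath ω l ∧ l.head? = some x ∧ l.getLast? = some y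

/-- The open cluster of `x`. -/
def cluster (ω : Edge → Bool) (x : V) : Set V := {y | ConnectedIn ω x y}

/-- The union `C∞` of the infinite open clusters (ℙ-a.s. the unique infinite cluster). -/
def Cinf (ω : Edge → Bool) : Set V := {x | (cluster ω x).Infinite}

def toR2 (v : V) : ℝ × ℝ := ((v.1 : ℝ), (v.2 : ℝ))

/-- `ℓ∞`-distance between a point of `ℝ²` and a lattice point. -/
noncomputable def distInf (x : ℝ × ℝ) (z : V) : ℝ :=
  max |x.1 - (z.1 : ℝ)| |x.2 - (z.2 : ℝ)|

/-- `ℓ∞`-norm of a lattice vector. -/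
noncomputable def normInfV (v : V) : ℝ := max |(v.1 : ℝ)| |(v.2 : ℝ)|

/-- `[x]` : the vertex of `C∞` nearest to `x` in `ℓ∞`-norm, ties broken by minimal `η`. -/
noncomputable def nearest (ω : Edge → Bool) (η : V → ℝ) (x : ℝ × ℝ) : V :=
  if h : ∃ z, z ∈ Cinf ω ∧ (∀ w ∈ Cinf ω, distInf x z ≤ distInf x w) ∧
      (∀ w ∈ Cinf ω, distInf x w = distInf x z → η z ≤ η w)
  then h.choose else 0

/-- The chemical distance `D_ω(x,y)` (`∞` if `x` and `y` are not connected). -/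
noncomputable def chemDist (ω : Edge → Bool) (x y : V) : ℝ≥0∞ :=
  sInf {r : ℝ≥0∞ | ∃ l, IsPath l ∧ IsOpenPath ω l ∧ l.head? = some x ∧
        l.getLast? = some y ∧ r = (pathLen l : ℝ≥0∞)}

/-- The subgraph induced on `U` by the open edges is connected. -/
def ConnectedInSet (ω : Edge → Bool) (U : Finset V) : Prop :=
  ∀ x ∈ U, ∀ y ∈ U, ∃ l, IsPath l ∧ IsOpenPath ω l ∧ l.head? = some x ∧
    l.getLast? = some y ∧ ∀ v ∈ l, v ∈ U

/-- The edge boundary `∂_{C∞} U`: edges of the graph `C∞` with exactly one endpoint in `U`. -/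
def edgeBoundary (ω : Edge → Bool) (U : Set V) : Set Edge :=
  {e | ω e = true ∧ edgeFst e ∈ Cinf ω ∧ edgeSnd e ∈ Cinf ω ∧
        ((edgeFst e ∈ U) ↔ edgeSnd e ∉ U)}

/-- The anchored isoperimetric profile `Φ_{C∞,0}(r)`. -/
noncomputable def profile (ω : Edge → Bool) (r : ℝ) : ℝ :=
  sInf {q : ℝ | ∃ U : Finset V, (0 : V) ∈ U ∧ ↑U ⊆ Cinf ω ∧ ConnectedInSet ω U ∧
        0 < U.card ∧ (U.card : ℝ) ≤ r ∧
        q = ((edgeBoundary ω ↑U).ncard : ℝ) / (U.card : ℝ)}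

/-- The box `B_∞(n) = [-n,n]² ∩ ℤ²`. -/
def box (n : ℕ) : Set V := {x | x.1.natAbs ≤ n ∧ x.2.natAbs ≤ n}

/-- The configuration restricted to the box `B_∞(n)`. -/
def restrictConf (ω : Edge → Bool) (n : ℕ) : Edge → Bool := fun e =>
  ω e && decide ((edgeFst e).1.natAbs ≤ n) && decide ((edgeFst e).2.natAbs ≤ n)
    && decide ((edgeSnd e).1.natAbs ≤ n) && decide ((edgeSnd e).2.natAbs ≤ n)

/-- `Cⁿ` : a largest open cluster of the configuration restricted to `B_∞(n)`. -/
noncomputable def giant (ω : Edge → Bool) (n : ℕ) : Set V :=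
  if h : ∃ x ∈ box n, ∀ y ∈ box n,
      (cluster (restrictConf ω n) y).ncard ≤ (cluster (restrictConf ω n) x).ncard
  then cluster (restrictConf ω n) h.choose else ∅

/-- The modified Cheeger constant `Φ̃_{Cⁿ} = Φ̃_{Cⁿ,C∞}`. -/
noncomputable def cheeger (ω : Edge → Bool) (n : ℕ) : ℝ :=
  sInf {q : ℝ | ∃ U : Finset V, ↑U ⊆ giant ω n ∧ 0 < U.card ∧
        (U.card : ℝ) ≤ ((giant ω n).ncard : ℝ) / 2 ∧
        q = ((edgeBoundary ω ↑U).ncard : ℝ) / (U.card : ℝ)}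

/-- The set `Û_{C∞}(n)` of minimizers of the anchored isoperimetric problem. -/
def profMinimizers (ω : Edge → Bool) (n : ℕ) : Set (Finset V) :=
  {U | (0 : V) ∈ U ∧ ↑U ⊆ Cinf ω ∧ ConnectedInSet ω U ∧ 0 < U.card ∧
       (U.card : ℝ) ≤ (n : ℝ) ∧
       ((edgeBoundary ω ↑U).ncard : ℝ) / (U.card : ℝ) = profile ω (n : ℝ)}

/-- The set `Û_{Cⁿ}` of minimizers of the modified Cheeger problem. -/
def cheegMinimizers (ω : Edge → Bool) (n : ℕ) : Set (Finset V) :=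
  {U | ↑U ⊆ giant ω n ∧ 0 < U.card ∧ (U.card : ℝ) ≤ ((giant ω n).ncard : ℝ) / 2 ∧
       ((edgeBoundary ω ↑U).ncard : ℝ) / (U.card : ℝ) = cheeger ω n}

/-- The Wulff set `W_p` associated with a boundary norm `β`. -/
def wulff (β : ℝ × ℝ → ℝ) : Set (ℝ × ℝ) :=
  {x | ∀ u : ℝ × ℝ, u.1 ^ 2 + u.2 ^ 2 = 1 → u.1 * x.1 + u.2 * x.2 ≤ β u}

/-- The Wulff shape `Ŵ_p`, normalized to unit Lebesgue area. -/
noncomputable def wulffHat (β : ℝ × ℝ → ℝ) : Set (ℝ × ℝ) :=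
  (Real.sqrt ((volume (wulff β)).toReal))⁻¹ • wulff β

/-- Partition sums approximating the `ρ`-length of the curve `γ : [0,1] → ℝ²`. -/
def lenSums (ρ : ℝ × ℝ → ℝ) (γ : ℝ → ℝ × ℝ) : Set ℝ :=
  {s | ∃ (N : ℕ) (t : ℕ → ℝ), 1 ≤ N ∧ (∀ i < N, t i < t (i + 1)) ∧ 0 ≤ t 0 ∧ t N ≤ 1 ∧
        s = ∑ i ∈ Finset.range N, ρ (γ (t (i + 1)) - γ (t i))}

/-- The `ρ`-length `len_ρ(γ)` of a curve. -/
noncomputable def lenOf (ρ : ℝ × ℝ → ℝ) (γ : ℝ → ℝ × ℝ) : ℝ := sSup (lenSums ρ γ)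

/-- A curve is rectifiable if its length (w.r.t. one, hence any, norm on `ℝ²`) is finite. -/
def Rectifiable (γ : ℝ → ℝ × ℝ) : Prop := BddAbove (lenSums (fun v => ‖v‖) γ)

/-- A Jordan curve: continuous on `[0,1]`, closed, and injective on `[0,1)`. -/
def IsJordan (γ : ℝ → ℝ × ℝ) : Prop :=
  ContinuousOn γ (Set.Icc 0 1) ∧ γ 0 = γ 1 ∧ Set.InjOn γ (Set.Ico 0 1)

/-- The interior of a Jordan curve: the bounded connected component of the complement. -/
def jordanInterior (γ : ℝ → ℝ × ℝ) : Set (ℝ × ℝ) :=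
  {x | x ∉ γ '' Set.Icc 0 1 ∧
       Bornology.IsBounded (connectedComponentIn (γ '' Set.Icc 0 1)ᶜ x)}

/-- The penalty function `h(t) = max (log⁴ t) 1`. -/
noncomputable def hPen (t : ℝ) : ℝ := max ((Real.log t) ^ 4) 1

/-- The modified right-boundary length `𝔟̂(γ) = 𝔟(γ) + h(‖y-x‖) 𝔭(γ)` of a right-most path
from `x` to `y`. -/
noncomputable def bHatLen (ω : Edge → Bool) (x y : V) (l : List V) : ℝ :=
  (bLen ω l : ℝ) + hPen (normInfV (y - x)) * (pLen ω l : ℝ)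

/-- The modified right-boundary distance `b̂(x,y)`. -/
noncomputable def bHat (ω : Edge → Bool) (x y : V) : ℝ :=
  sInf {r : ℝ | ∃ l, InR x y l ∧ r = bHatLen ω x y l}

/-- The set `Γ̂(x,y)` of minimizers of the modified right-boundary distance. -/
def hatMinimizers (ω : Edge → Bool) (x y : V) : Set (List V) :=
  {l | InR x y l ∧ bHatLen ω x y l = bHat ω x y}

/-- The set `Γ_ε(x,y)` of `ε`-optimal open right-most paths. -/
def GammaEps (ω : Edge → Bool) (ε : ℝ) (x y : V) : Set (List V) :=
  {l | InR x y l ∧ IsOpenPath ω l ∧ (bLen ω l : ℝ) - bDist ω x y ≤ ε * normInfV (y - x)}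

/-- The set `Γ₀(x,y)` of minimizing open right-most paths. -/
def Gamma0 (ω : Edge → Bool) (x y : V) : Set (List V) :=
  {l | InR x y l ∧ IsOpenPath ω l ∧ (bLen ω l : ℝ) = bDist ω x y}

/-- Codomains of the coordinate random variables: the edge variables `ω(e)` and the
tie-breaking variables `η_z`. -/
def CoordType : Edge ⊕ V → Type
  | .inl _ => Bool
  | .inr _ => ℝ

noncomputable instance coordMeasurableSpace : ∀ i : Edge ⊕ V, MeasurableSpace (CoordType i)
  | .inl _ => inferInstanceAs (MeasurableSpace Bool)
  | .inr _ => inferInstanceAs (MeasurableSpace ℝ)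

/-- The family of all coordinate random variables `(ω(e))_e , (η_z)_z`. -/
def coordMap {Ω : Type} (ωc : Ω → Edge → Bool) (η : Ω → V → ℝ) :
    ∀ i : Edge ⊕ V, Ω → CoordType i
  | .inl e => fun o => ωc o e
  | .inr z => fun o => η o z


/-- Two lattice neighbours differ by one of the four unit vectors. -/
lemma LatticeAdj.sub_cases {x y : V} (h : LatticeAdj x y) :
    x - y = (1, 0) ∨ x - y = (0, 1) ∨ x - y = (-1, 0) ∨ x - y = (0, -1) := by
  obtain ⟨x₁, x₂⟩ := x
  obtain ⟨y₁, y₂⟩ := y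
  simp only [LatticeAdj] at h
  simp only [Prod.mk_sub_mk, Prod.mk.injEq]
  omega

lemma LatticeAdj.symm {x y : V} (h : LatticeAdj x y) : LatticeAdj y x := by
  simp only [LatticeAdj] at h ⊢
  omega

/-- Rotation by a quarter turn counterclockwise. -/
def rotLeft (v : V) : V := (-v.2, v.1)

/-- Unless a path turns right at `cur`, the edge first counterclockwise after the incoming one
is a right-boundary edge. -/
lemma eq_add_rotLeft_or_mem_rbAt {prev cur next : V} (h₁ : LatticeAdj prev cur)
    (h₂ : LatticeAdj cur next) :
    next = cur + rotLeft (prev - cur) ∨ (cur, cur + rotLeft (prev - cur)) ∈ rbAt prev cur next := by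
  rw [← sub_eq_iff_eq_add']
  unfold rbAt
  rcases h₁.sub_cases with h | h | h | h <;> rcases h₂.symm.sub_cases with h' | h' | h' | h' <;>
    simp [h, h', rotLeft, dirIdx, dirVec, List.range_succ]

lemma length_rbAt_le (prev cur next : V) : (rbAt prev cur next).length ≤ 3 := by
  unfold rbAt
  rw [List.length_map, show List.range 4 = 0 :: [1, 2, 3] from rfl,
    List.filter_cons_of_neg (by simp)]
  exact List.length_filter_le _ _

lemma length_rightBoundary_le : ∀ l : List V, (rightBoundary l).length ≤ 3 * pathLen l
  | [] | [_] | [_, _] => by simp [rightBoundary]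
  | a :: b :: c :: rest => by
    have h₁ := length_rbAt_le a b c
    have h₂ := length_rightBoundary_le (b :: c :: rest)
    simp only [rightBoundary, pathLen, List.length_append, List.length_cons] at h₂ ⊢
    omega

lemma IsRightMost.tail {a b : V} {l : List V} (h : IsRightMost (a :: b :: l)) :
    IsRightMost (b :: l) := by
  obtain ⟨⟨-, hc⟩, hn, hr⟩ := h
  have hs : steps (a :: b :: l) = (a, b) :: steps (b :: l) := by simp [steps]
  rw [hs] at hn hr
  refine ⟨⟨by simp, (List.isChain_cons_cons.1 hc).2⟩, (List.nodup_cons.1 hn).2, fun e he => ?_⟩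
  have he' : e ∈ rightBoundary (a :: b :: l) := by
    cases l with
    | nil => simp [rightBoundary] at he
    | cons c l => simpa [rightBoundary] using Or.inr he
  exact ⟨fun h => (hr e he').1 (List.mem_cons_of_mem _ h),
    fun h => (hr e he').2 (List.mem_cons_of_mem _ h)⟩

/-- A right-most path cannot be continued after three consecutive right turns. -/
lemma IsRightMost.exists_rbAt_ne_nil {a b c d e f : V} {l : List V}
    (h : IsRightMost (a :: b :: c :: d :: e :: f :: l)) :
    rbAt a b c ≠ [] ∨ rbAt b c d ≠ [] ∨ rbAt c d e ≠ [] := by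
  by_contra! hcon
  obtain ⟨h₁, h₂, h₃⟩ := hcon
  obtain ⟨⟨-, hc⟩, hn, hr⟩ := h
  replace hc : List.IsChain LatticeAdj (a :: b :: c :: d :: e :: f :: l) := hc
  simp only [List.isChain_cons_cons] at hc
  obtain ⟨hab, hbc, hcd, hde, hef, -⟩ := hc
  have hc := (eq_add_rotLeft_or_mem_rbAt hab hbc).resolve_right (by simp [h₁])
  have hd := (eq_add_rotLeft_or_mem_rbAt hbc hcd).resolve_right (by simp [h₂])
  have he := (eq_add_rotLeft_or_mem_rbAt hcd hde).resolve_right (by simp [h₃])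
  have hea : e = a := by
    rw [he, hd, hc]
    ext <;> simp [rotLeft] <;> ring
  have hb : e + rotLeft (d - e) = b := by
    rw [hea, hd, hc]
    ext <;> simp [rotLeft] <;> ring
  have hf := eq_add_rotLeft_or_mem_rbAt hde hef
  rw [hb] at hf
  rcases hf with rfl | hf
  · simp [steps, hea] at hn
  · exact (hr (e, b) (by simp [rightBoundary, hf])).1 (by simp [steps, hea])

lemma IsRightMost.pathLen_le : ∀ {l : List V}, IsRightMost l →
    pathLen l ≤ 3 * (rightBoundary l).length + 6
  | [], _ | [_], _ | [_, _], _ | [_, _, _], _ | [_, _, _, _], _ | [_, _, _, _, _], _ => by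
    simp [pathLen]
  | a :: b :: c :: d :: e :: f :: l, h => by
    have ih := h.tail.tail.tail.pathLen_le
    have hne := h.exists_rbAt_ne_nil
    simp only [← List.length_pos_iff] at hne
    simp only [rightBoundary, pathLen, List.length_append, List.length_cons] at ih ⊢
    omega

/-- Lemma 2.4: length of the right boundary. -/
theorem rightBoundary_length_bounds (l : List V) (h : IsRightMost l) :
    (pathLen l : ℝ) / 3 - 2 ≤ ((rightBoundary l).length : ℝ) ∧
      ((rightBoundary l).length : ℝ) ≤ 3 * (pathLen l : ℝ) := by
  have h₁ : (pathLen l : ℝ) ≤ 3 * (rightBoundary l).length + 6 := mod_cast h.pathLen_le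
  exact ⟨by linarith, mod_cast length_rightBoundary_le l⟩

end Perc
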